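/- Let d ≥ 1, let M be a symmetric positive semidefinite d×d real matrix, let α : [0,∞) → [0,∞) be nondecreasing, and set ‖x‖_M = (xᵀMx)^{1/2}. Define φ : ℝ^d → ℝ^d by φ(x) = (α(‖x‖_M)/‖x‖_M)·M·x when ‖x‖_M > 0 and φ(x) = 0 when ‖x‖_M = 0. Let X be a random vector in ℝ^d with E[‖X‖₂²] < ∞ and E[‖φ(X)‖₂²] < ∞. Then the law of the pair (X, φ(X)) is an optimal coupling of the law of X and the law of φ(X) with respect to the 2-Wasserstein distance. -/

import Mathlib

open MeasureTheory ProbabilityTheory Matrix Finset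
open scoped ENNReal

noncomputable section

/-- A coupling of `μ` and `ν`: a probability measure on the product with the
prescribed marginals. -/
def IsCoupling {d : ℕ} (π : Measure ((Fin d → ℝ) × (Fin d → ℝ)))
    (μ ν : Measure (Fin d → ℝ)) : Prop :=
  IsProbabilityMeasure π ∧ π.map Prod.fst = μ ∧ π.map Prod.snd = ν

/-- Squared Euclidean distance on `ℝ^d`. -/
def sqDist {d : ℕ} (x y : Fin d → ℝ) : ℝ := ∑ i, (x i - y i) ^ 2

/-- The squared 2-Wasserstein distance: infimum of the quadratic transport cost
over all couplings. -/
def W2sq {d : ℕ} (μ ν : Measure (Fin d → ℝ)) : ℝ≥0∞ :=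
  ⨅ (π : Measure ((Fin d → ℝ) × (Fin d → ℝ))) (_ : IsCoupling π μ ν),
    ∫⁻ p, ENNReal.ofReal (sqDist p.1 p.2) ∂π

/-- Quantile (generalized inverse cdf) of a measure on `ℝ`. -/
def quantile (μ : Measure ℝ) (t : ℝ) : ℝ := sInf {s : ℝ | t ≤ cdf μ s}


/-- The seminorm `‖x‖_M = (xᵀ M x)^{1/2}` induced by a positive semidefinite matrix. -/
def mNorm {d : ℕ} (M : Matrix (Fin d) (Fin d) ℝ) (x : Fin d → ℝ) : ℝ :=
  Real.sqrt (x ⬝ᵥ (M *ᵥ x))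

/-- Cauchy–Schwarz for the form `xᵀ M y` of a positive semidefinite matrix. -/
lemma dotProduct_mulVec_le_mNorm_mul {d : ℕ} {M : Matrix (Fin d) (Fin d) ℝ} (hM : M.PosSemidef)
    (x y : Fin d → ℝ) : (M *ᵥ x) ⬝ᵥ y ≤ mNorm M x * mNorm M y := by
  have nonneg (z : Fin d → ℝ) : 0 ≤ z ⬝ᵥ (M *ᵥ z) := by
    simpa using hM.dotProduct_mulVec_nonneg z
  have symm : x ⬝ᵥ (M *ᵥ y) = (M *ᵥ x) ⬝ᵥ y := by
    have hT : Mᵀ = M := by simpa using hM.isHermitian.eq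
    rw [dotProduct_mulVec, ← mulVec_transpose, hT]
  have key := discrim_le_zero (a := x ⬝ᵥ (M *ᵥ x)) (b := 2 * ((M *ᵥ x) ⬝ᵥ y))
    (c := y ⬝ᵥ (M *ᵥ y)) fun t => by
      have h := nonneg (t • x + y)
      simp only [mulVec_add, mulVec_smul, dotProduct_add, add_dotProduct, smul_dotProduct,
        dotProduct_smul, smul_eq_mul, symm, dotProduct_comm y (M *ᵥ x)] at h
      linarith
  rw [discrim] at key
  rw [mNorm, mNorm, ← Real.sqrt_mul (nonneg x)]
  exact Real.le_sqrt_of_sq_le (by linarith)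

lemma continuous_mNorm {d : ℕ} (M : Matrix (Fin d) (Fin d) ℝ) : Continuous (mNorm M) := by
  unfold mNorm
  fun_prop

lemma mNorm_mul_self {d : ℕ} {M : Matrix (Fin d) (Fin d) ℝ} (hM : M.PosSemidef)
    (x : Fin d → ℝ) : (M *ᵥ x) ⬝ᵥ x = mNorm M x * mNorm M x := by
  rw [mNorm, Real.mul_self_sqrt (by simpa using hM.dotProduct_mulVec_nonneg x), dotProduct_comm]

/-- The tangent-line inequality for the primitive of a monotone function. -/
lemma Monotone.mul_sub_le_integral {β : ℝ → ℝ} (hβ : Monotone β) (r s : ℝ) :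
    β r * (s - r) ≤ ∫ t in r..s, β t := by
  rcases le_total r s with h | h
  · have := intervalIntegral.integral_mono_on h (intervalIntegrable_const (c := β r))
      (hβ.intervalIntegrable (μ := volume)) fun t ht => hβ ht.1
    simpa [mul_comm] using this
  · have := intervalIntegral.integral_mono_on h (hβ.intervalIntegrable (μ := volume))
      (intervalIntegrable_const (c := β r)) fun t ht => hβ ht.2
    rw [intervalIntegral.integral_symm]
    simp only [intervalIntegral.integral_const, smul_eq_mul] at this
    linarith

lemma sqDist_eq {d : ℕ} (x y : Fin d → ℝ) :
    sqDist x y = ∑ i, x i ^ 2 + ∑ i, y i ^ 2 - 2 * (y ⬝ᵥ x) := by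
  simp only [sqDist, dotProduct, Finset.mul_sum, ← Finset.sum_add_distrib,
    ← Finset.sum_sub_distrib]
  exact Finset.sum_congr rfl fun i _ => by ring

lemma measurable_sqDist {d : ℕ} :
    Measurable fun p : (Fin d → ℝ) × (Fin d → ℝ) => sqDist p.1 p.2 := by
  unfold sqDist
  fun_prop

/-- The countable Legendre transform of `u`, taken along a dense sequence. -/
def denseConj {d : ℕ} (u : (Fin d → ℝ) → ℝ) (y : Fin d → ℝ) : ℝ :=
  ⨆ n, (y ⬝ᵥ TopologicalSpace.denseSeq (Fin d → ℝ) n - u (TopologicalSpace.denseSeq (Fin d → ℝ) n))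

lemma measurable_denseConj {d : ℕ} (u : (Fin d → ℝ) → ℝ) : Measurable (denseConj u) := by
  refine Measurable.iSup fun n => ?_
  unfold dotProduct
  fun_prop

/-- Fenchel's inequality extends from the dense sequence to the whole space. -/
lemma dotProduct_sub_le_of_denseSeq {d : ℕ} {u : (Fin d → ℝ) → ℝ} (hu : Continuous u)
    {y : Fin d → ℝ} {c : ℝ} (h : ∀ n, y ⬝ᵥ TopologicalSpace.denseSeq (Fin d → ℝ) n -
      u (TopologicalSpace.denseSeq (Fin d → ℝ) n) ≤ c) (x : Fin d → ℝ) :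
    y ⬝ᵥ x - u x ≤ c := by
  have hc : IsClosed {x | y ⬝ᵥ x - u x ≤ c} :=
    isClosed_le (by unfold dotProduct; fun_prop) continuous_const
  refine (TopologicalSpace.denseRange_denseSeq (Fin d → ℝ)).induction_on x hc h

/-- A measurable selection of the subdifferential of a continuous function transports
optimally for the quadratic cost. -/
theorem lintegral_sqDist_map_eq_W2sq {d : ℕ} {Ω : Type*} [MeasurableSpace Ω] {P : Measure Ω}
    [IsProbabilityMeasure P] {u : (Fin d → ℝ) → ℝ} (hu : Continuous u)
    {T : (Fin d → ℝ) → Fin d → ℝ} (hT : Measurable T)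
    (hsub : ∀ x y, u x + T x ⬝ᵥ (y - x) ≤ u y)
    {X : Ω → Fin d → ℝ} (hX : Measurable X)
    (hX2 : Integrable (fun ω => ∑ i, X ω i ^ 2) P)
    (hTX2 : Integrable (fun ω => ∑ i, T (X ω) i ^ 2) P)
    (huX : Integrable (fun ω => u (X ω)) P) :
    (∫⁻ p, ENNReal.ofReal (sqDist p.1 p.2) ∂(Measure.map (fun ω => (X ω, T (X ω))) P)) =
      W2sq (Measure.map X P) (Measure.map (fun ω => T (X ω)) P) := by
  have hTX : Measurable fun ω => T (X ω) := hT.comp hX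
  have hpair : Measurable fun ω => (X ω, T (X ω)) := hX.prodMk hTX
  have hsub' (x y : Fin d → ℝ) : T x ⬝ᵥ y - u y ≤ T x ⬝ᵥ x - u x := by
    have := hsub x y
    rw [dotProduct_sub] at this
    linarith
  have hle (x : Fin d → ℝ) (n : ℕ) : T x ⬝ᵥ TopologicalSpace.denseSeq (Fin d → ℝ) n -
      u (TopologicalSpace.denseSeq (Fin d → ℝ) n) ≤ denseConj u (T x) :=
    le_ciSup (f := fun n => T x ⬝ᵥ TopologicalSpace.denseSeq (Fin d → ℝ) n -
      u (TopologicalSpace.denseSeq (Fin d → ℝ) n))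
      ⟨T x ⬝ᵥ x - u x, Set.forall_mem_range.2 fun n => hsub' x _⟩ n
  have hconj (x : Fin d → ℝ) : denseConj u (T x) = T x ⬝ᵥ x - u x :=
    le_antisymm (ciSup_le fun n => hsub' x _) (dotProduct_sub_le_of_denseSeq hu (hle x) x)
  have hcross : Integrable (fun ω => T (X ω) ⬝ᵥ X ω) P := by
    refine (hX2.add hTX2).mono' (by unfold dotProduct; fun_prop) (ae_of_all _ fun ω => ?_)
    rw [Real.norm_eq_abs, Pi.add_apply, ← Finset.sum_add_distrib]
    refine (Finset.abs_sum_le_sum_abs _ _).trans (Finset.sum_le_sum fun i _ => ?_)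
    rw [abs_mul]
    nlinarith [sq_abs (X ω i), sq_abs (T (X ω) i), sq_nonneg (|X ω i| - |T (X ω) i|),
      sq_nonneg (X ω i), sq_nonneg (T (X ω) i)]
  let f : (Fin d → ℝ) → ℝ := fun x => ∑ i, x i ^ 2 - 2 * u x
  let g : (Fin d → ℝ) → ℝ := fun y => ∑ i, y i ^ 2 - 2 * denseConj u y
  have hfm : Measurable f := by
    have := hu.measurable
    fun_prop
  have hgm : Measurable g := by
    have := measurable_denseConj u
    fun_prop
  have hfX : Integrable (fun ω => f (X ω)) P := hX2.sub (huX.const_mul 2)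
  have hgX : Integrable (fun ω => g (T (X ω))) P := by
    simp only [g, hconj]
    exact hTX2.sub ((hcross.sub huX).const_mul 2)
  have hfg (x : Fin d → ℝ) : sqDist x (T x) = f x + g (T x) := by
    simp only [f, g, hconj, sqDist_eq]
    ring
  have hcost : (∫⁻ p, ENNReal.ofReal (sqDist p.1 p.2) ∂(Measure.map (fun ω => (X ω, T (X ω))) P))
      = ENNReal.ofReal (∫ x, f x ∂(Measure.map X P) +
        ∫ y, g y ∂(Measure.map (fun ω => T (X ω)) P)) := by
    rw [lintegral_map measurable_sqDist.ennreal_ofReal hpair,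
      integral_map hX.aemeasurable hfm.aestronglyMeasurable,
      integral_map hTX.aemeasurable hgm.aestronglyMeasurable, ← integral_add hfX hgX,
      ofReal_integral_eq_lintegral_ofReal (f := fun ω => f (X ω) + g (T (X ω)))
        (hfX.add hgX) (ae_of_all _ fun ω => ?_)]
    · simp only [hfg]
    · change 0 ≤ f (X ω) + g (T (X ω))
      rw [← hfg]
      exact Finset.sum_nonneg fun i _ => sq_nonneg _
  refine le_antisymm ?_ (iInf₂_le _ ?_)
  · rw [hcost]
    refine le_iInf₂ fun π ⟨hπ, hfst, hsnd⟩ => ?_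
    have hae : ∀ᵐ y ∂(Measure.map (fun ω => T (X ω)) P), ∀ n,
        y ⬝ᵥ TopologicalSpace.denseSeq (Fin d → ℝ) n -
          u (TopologicalSpace.denseSeq (Fin d → ℝ) n) ≤ denseConj u y := by
      rw [ae_all_iff]
      intro n
      rw [ae_map_iff hTX.aemeasurable]
      · exact ae_of_all _ fun ω => hle _ n
      · exact measurableSet_le (by unfold dotProduct; fun_prop) (measurable_denseConj u)
    have hfi : Integrable (fun p : (Fin d → ℝ) × (Fin d → ℝ) => f p.1) π := by
      have : Integrable f (π.map Prod.fst) := by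
        rw [hfst, integrable_map_measure hfm.aestronglyMeasurable hX.aemeasurable]
        exact hfX
      exact this.comp_measurable measurable_fst
    have hgi : Integrable (fun p : (Fin d → ℝ) × (Fin d → ℝ) => g p.2) π := by
      have : Integrable g (π.map Prod.snd) := by
        rw [hsnd, integrable_map_measure hgm.aestronglyMeasurable hTX.aemeasurable]
        exact hgX
      exact this.comp_measurable measurable_snd
    have hdual : ∀ᵐ p ∂π, f p.1 + g p.2 ≤ sqDist p.1 p.2 := by
      rw [← hsnd] at hae
      filter_upwards [ae_of_ae_map measurable_snd.aemeasurable hae] with p hp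
      have := dotProduct_sub_le_of_denseSeq hu hp p.1
      rw [sqDist_eq]
      simp only [f, g]
      linarith
    rw [← hfst, ← hsnd, integral_map measurable_fst.aemeasurable hfm.aestronglyMeasurable,
      integral_map measurable_snd.aemeasurable hgm.aestronglyMeasurable, ← integral_add hfi hgi]
    calc ENNReal.ofReal (∫ p, (f p.1 + g p.2) ∂π)
        ≤ ENNReal.ofReal (∫ p, max (f p.1 + g p.2) 0 ∂π) :=
          ENNReal.ofReal_le_ofReal (integral_mono (hfi.add hgi) (hfi.add hgi).pos_part
            fun p => le_max_left _ _)
      _ = ∫⁻ p, ENNReal.ofReal (max (f p.1 + g p.2) 0) ∂π :=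
          ofReal_integral_eq_lintegral_ofReal (hfi.add hgi).pos_part
            (ae_of_all _ fun p => le_max_right _ _)
      _ ≤ ∫⁻ p, ENNReal.ofReal (sqDist p.1 p.2) ∂π :=
          lintegral_mono_ae (hdual.mono fun p hp => ENNReal.ofReal_le_ofReal
            (max_le hp (Finset.sum_nonneg fun i _ => sq_nonneg _)))
  · exact ⟨Measure.isProbabilityMeasure_map hpair.aemeasurable,
      by rw [Measure.map_map measurable_fst hpair]; rfl,
      by rw [Measure.map_map measurable_snd hpair]; rfl⟩

theorem radial_psd_transform_optimal_coupling
    {d : ℕ} (hd : 1 ≤ d)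
    {Ω : Type*} [MeasureSpace Ω] [IsProbabilityMeasure (ℙ : Measure Ω)]
    (M : Matrix (Fin d) (Fin d) ℝ) (hM : M.PosSemidef)
    (α : ℝ → ℝ)
    (hαmono : MonotoneOn α (Set.Ici 0))
    (hαnonneg : ∀ r, 0 ≤ r → 0 ≤ α r)
    (φ : (Fin d → ℝ) → Fin d → ℝ)
    (hφ : ∀ x, φ x = if 0 < mNorm M x then (α (mNorm M x) / mNorm M x) • (M *ᵥ x) else 0)
    (X : Ω → Fin d → ℝ) (hXmeas : Measurable X)
    (hX2 : Integrable (fun ω => ∑ i, X ω i ^ 2) ℙ)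
    (hφX2 : Integrable (fun ω => ∑ i, φ (X ω) i ^ 2) ℙ) :
    IsCoupling (Measure.map (fun ω => (X ω, φ (X ω))) ℙ)
      (Measure.map X ℙ) (Measure.map (fun ω => φ (X ω)) ℙ) ∧
    (∫⁻ p, ENNReal.ofReal (sqDist p.1 p.2)
        ∂(Measure.map (fun ω => (X ω, φ (X ω))) ℙ)) =
      W2sq (Measure.map X ℙ) (Measure.map (fun ω => φ (X ω)) ℙ) := by
  have hβ : Monotone fun t => α (max t 0) := fun s t hst =>
    hαmono (Set.mem_Ici.2 (le_max_right _ _)) (Set.mem_Ici.2 (le_max_right _ _))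
      (max_le_max_right 0 hst)
  have hφ' (x : Fin d → ℝ) : φ x = (α (max (mNorm M x) 0) / mNorm M x) • (M *ᵥ x) := by
    have h0 : 0 ≤ mNorm M x := Real.sqrt_nonneg _
    rw [hφ, max_eq_left h0]
    split_ifs with h
    · rfl
    · simp [le_antisymm (not_lt.1 h) h0]
  have hφm : Measurable φ := by
    have h1 := (continuous_mNorm M).measurable
    have h2 := hβ.measurable.comp h1
    have h3 : Measurable fun x => M *ᵥ x := by fun_prop
    rw [funext hφ']
    exact (h2.div h1).smul h3
  have hφX : Measurable fun ω => φ (X ω) := hφm.comp hXmeas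
  have hpair : Measurable fun ω => (X ω, φ (X ω)) := hXmeas.prodMk hφX
  let u : (Fin d → ℝ) → ℝ := fun x => ∫ t in (0 : ℝ)..mNorm M x, α (max t 0)
  have hu : Continuous u :=
    (intervalIntegral.continuous_primitive (fun a b => hβ.intervalIntegrable) 0).comp
      (continuous_mNorm M)
  have hu0 (x : Fin d → ℝ) : 0 ≤ u x :=
    intervalIntegral.integral_nonneg (Real.sqrt_nonneg _) fun t _ => hαnonneg _ (le_max_right _ _)
  have hsub (x y : Fin d → ℝ) : u x + φ x ⬝ᵥ (y - x) ≤ u y := by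
    have hx : 0 ≤ mNorm M x := Real.sqrt_nonneg _
    rcases hx.eq_or_lt with h | h
    · have hux : u x = 0 := by simp [u, ← h]
      rw [hφ, if_neg h.ge.not_gt, hux, zero_dotProduct, zero_add]
      exact hu0 y
    · have hint : u y - u x = ∫ t in mNorm M x..mNorm M y, α (max t 0) :=
        intervalIntegral.integral_interval_sub_left hβ.intervalIntegrable hβ.intervalIntegrable
      have htan := hβ.mul_sub_le_integral (mNorm M x) (mNorm M y)
      have hcs := dotProduct_mulVec_le_mNorm_mul hM x y
      have hle : φ x ⬝ᵥ (y - x) ≤ α (max (mNorm M x) 0) * (mNorm M y - mNorm M x) := by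
        rw [hφ', smul_dotProduct, smul_eq_mul, dotProduct_sub, mNorm_mul_self hM]
        calc _ ≤ α (max (mNorm M x) 0) / mNorm M x *
              (mNorm M x * mNorm M y - mNorm M x * mNorm M x) :=
              mul_le_mul_of_nonneg_left (by linarith)
                (div_nonneg (hαnonneg _ (le_max_right _ _)) hx)
          _ = _ := by field_simp
      linarith
  have huX : Integrable (fun ω => u (X ω)) ℙ := by
    refine (hX2.add hφX2).mono' (hu.measurable.comp hXmeas).aestronglyMeasurable
      (ae_of_all _ fun ω => ?_)
    have h := hsub (X ω) 0
    have hz : u 0 = 0 := by simp [u, mNorm]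
    rw [hz, zero_sub, dotProduct_neg] at h
    rw [Real.norm_of_nonneg (hu0 _), Pi.add_apply, ← Finset.sum_add_distrib]
    refine (show u (X ω) ≤ φ (X ω) ⬝ᵥ X ω by linarith).trans (Finset.sum_le_sum fun i _ => ?_)
    nlinarith [sq_nonneg (X ω i - φ (X ω) i), sq_nonneg (X ω i), sq_nonneg (φ (X ω) i)]
  refine ⟨⟨Measure.isProbabilityMeasure_map hpair.aemeasurable, ?_, ?_⟩,
    lintegral_sqDist_map_eq_W2sq hu hφm hsub hXmeas hX2 hφX2 huX⟩
  · rw [Measure.map_map measurable_fst hpair]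
    rfl
  · rw [Measure.map_map measurable_snd hpair]
    rfl
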